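/- On $\mathbb{R}^{2n}$ with extended Flaschka coordinates $(a_1,\dots,a_n,b_1,\dots,b_n)$, the bracket determined by $\{a_i,a_{i+1}\}_1 = -a_i a_{i+1}$ ($i \le n-2$), $\{a_{n-1},a_n\}_1 = -a_{n-1}$, $\{a_i,b_i\}_1 = a_i b_i$ and $\{a_i,b_{i+1}\}_1 = -a_i b_{i+1}$ ($i \le n-1$), $\{a_n,b_n\}_1 = b_n$, $\{b_i,b_{i+1}\}_1 = -a_i$ ($i \le n-1$), and all other coordinate brackets zero, satisfies the Jacobi identity. -/

import Mathlib

open scoped BigOperators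

/-- Phase space `ℝ^{2n}` with extended Flaschka coordinates `(a, b)`. -/
abbrev FlkPt (n : ℕ) := (Fin n → ℝ) × (Fin n → ℝ)

/-- Partial derivative with respect to `a i`. -/
noncomputable def da {n : ℕ} (f : FlkPt n → ℝ) (i : Fin n) (z : FlkPt n) : ℝ :=
  fderiv ℝ f z (Pi.single i 1, 0)

/-- Partial derivative with respect to `b i`. -/
noncomputable def db {n : ℕ} (f : FlkPt n → ℝ) (i : Fin n) (z : FlkPt n) : ℝ :=
  fderiv ℝ f z (0, Pi.single i 1)

/-- The first Toda bracket in extended Flaschka coordinates, determined by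
`{a i, b i}₀ = a i` and `{a i, b (i+1)}₀ = - a i` (for `i = 1,…,n-1`) and
`{a n, b n}₀ = 1`. -/
noncomputable def flk0 {n : ℕ} (f g : FlkPt n → ℝ) (z : FlkPt n) : ℝ :=
  (∑ i : Fin n, (if (i : ℕ) + 1 < n then z.1 i else 1)
      * (da f i z * db g i z - da g i z * db f i z))
  + ∑ i : Fin n, ∑ j : Fin n, if (j : ℕ) = (i : ℕ) + 1 then
      (-(z.1 i)) * (da f i z * db g j z - da g i z * db f j z) else 0

/-- The second Toda bracket in extended Flaschka coordinates, determined by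
`{a i, a (i+1)}₁ = - a i * a (i+1)` (`i ≤ n-2`), `{a (n-1), a n}₁ = - a (n-1)`,
`{a i, b i}₁ = a i * b i` and `{a i, b (i+1)}₁ = - a i * b (i+1)` (`i ≤ n-1`),
`{a n, b n}₁ = b n`, and `{b i, b (i+1)}₁ = - a i` (`i ≤ n-1`). -/
noncomputable def flk1 {n : ℕ} (f g : FlkPt n → ℝ) (z : FlkPt n) : ℝ :=
  (∑ i : Fin n, ∑ j : Fin n, if (j : ℕ) = (i : ℕ) + 1 then
      (if (j : ℕ) + 1 < n then -(z.1 i * z.1 j) else -(z.1 i))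
        * (da f i z * da g j z - da g i z * da f j z) else 0)
  + (∑ i : Fin n, (if (i : ℕ) + 1 < n then z.1 i * z.2 i else z.2 i)
      * (da f i z * db g i z - da g i z * db f i z))
  + (∑ i : Fin n, ∑ j : Fin n, if (j : ℕ) = (i : ℕ) + 1 then
      (-(z.1 i * z.2 j)) * (da f i z * db g j z - da g i z * db f j z) else 0)
  + (∑ i : Fin n, ∑ j : Fin n, if (j : ℕ) = (i : ℕ) + 1 then
      (-(z.1 i)) * (db f i z * db g j z - db g i z * db f j z) else 0)

section BivectorBracket

variable {ι E : Type*} [Fintype ι] [NormedAddCommGroup E] [NormedSpace ℝ E]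

/-- The bracket of the bivector with components `π p q` in the directions `e p`, `e q`. -/
noncomputable def bivectorBracket (e : ι → E) (π : ι → ι → E → ℝ) (f g : E → ℝ) (z : E) : ℝ :=
  ∑ p, ∑ q, π p q z * (fderiv ℝ f z (e p) * fderiv ℝ g z (e q))

/-- The Hamiltonian vector field of `g` for `bivectorBracket e π`. -/
noncomputable def hamiltonianVector (e : ι → E) (π : ι → ι → E → ℝ) (g : E → ℝ) (z : E) : E :=
  ∑ q, fderiv ℝ g z (e q) • ∑ p, π p q z • e p

theorem bivectorBracket_eq_fderiv (e : ι → E) (π : ι → ι → E → ℝ) (f g : E → ℝ) (z : E) :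
    bivectorBracket e π f g z = fderiv ℝ f z (hamiltonianVector e π g z) := by
  simp only [bivectorBracket, hamiltonianVector, map_sum, map_smul, smul_eq_mul, Finset.mul_sum]
  rw [Finset.sum_comm]
  exact Finset.sum_congr rfl fun _ _ => Finset.sum_congr rfl fun _ _ => by ring

theorem fderiv_bivectorBracket (e : ι → E) {π : ι → ι → E → ℝ}
    (hπ : ∀ p q, Differentiable ℝ (π p q)) (hanti : ∀ p q z, π p q z = -π q p z)
    {f g : E → ℝ} (hf : ContDiff ℝ 2 f) (hg : ContDiff ℝ 2 g) (z v : E) :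
    fderiv ℝ (bivectorBracket e π f g) z v =
      (∑ p, ∑ q, fderiv ℝ (π p q) z v * (fderiv ℝ f z (e p) * fderiv ℝ g z (e q)))
      + fderiv ℝ (fderiv ℝ f) z v (hamiltonianVector e π g z)
      - fderiv ℝ (fderiv ℝ g) z v (hamiltonianVector e π f z) := by
  have hD : ∀ {k : E → ℝ}, ContDiff ℝ 2 k → ∀ w : E,
      HasFDerivAt (fun y => fderiv ℝ k y w) ((fderiv ℝ (fderiv ℝ k) z).flip w) z := by
    intro k hk w
    have hk' : DifferentiableAt ℝ (fderiv ℝ k) z :=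
      (hk.fderiv_right (m := 1) (by norm_num)).differentiable (by norm_num) z
    simpa using hk'.hasFDerivAt.clm_apply (hasFDerivAt_const w z)
  have hB : HasFDerivAt (bivectorBracket e π f g) _ z :=
    HasFDerivAt.fun_sum fun p (_ : p ∈ Finset.univ) =>
      HasFDerivAt.fun_sum fun q (_ : q ∈ Finset.univ) =>
        (hπ p q z).hasFDerivAt.mul ((hD hf (e p)).mul (hD hg (e q)))
  have hg' : fderiv ℝ (fderiv ℝ g) z v (hamiltonianVector e π f z) =
      -∑ p, ∑ q, π p q z * (fderiv ℝ f z (e p) * fderiv ℝ (fderiv ℝ g) z v (e q)) := by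
    simp only [hamiltonianVector, map_sum, map_smul, smul_eq_mul, Finset.mul_sum,
      ← Finset.sum_neg_distrib]
    refine Finset.sum_congr rfl fun p _ => Finset.sum_congr rfl fun q _ => ?_
    rw [hanti q p]; ring
  have hf' : fderiv ℝ (fderiv ℝ f) z v (hamiltonianVector e π g z) =
      ∑ p, ∑ q, π p q z * (fderiv ℝ (fderiv ℝ f) z v (e p) * fderiv ℝ g z (e q)) := by
    simp only [hamiltonianVector, map_sum, map_smul, smul_eq_mul, Finset.mul_sum]
    rw [Finset.sum_comm]
    exact Finset.sum_congr rfl fun _ _ => Finset.sum_congr rfl fun _ _ => by ring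
  rw [hB.fderiv, hf', hg', sub_neg_eq_add]
  simp only [← Finset.sum_add_distrib, sum_apply]
  refine Finset.sum_congr rfl fun p _ => Finset.sum_congr rfl fun q _ => ?_
  simp only [add_apply, smul_apply,
    ContinuousLinearMap.flip_apply, smul_eq_mul]
  ring

/-- If the coordinate Jacobi identities hold, so does the Jacobi identity of the bracket. -/
theorem bivectorBracket_jacobi (e : ι → E) {π : ι → ι → E → ℝ}
    (hπ : ∀ p q, Differentiable ℝ (π p q)) (hanti : ∀ p q z, π p q z = -π q p z)
    (hJ : ∀ p q r z, fderiv ℝ (π p q) z (∑ s, π s r z • e s)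
      + fderiv ℝ (π q r) z (∑ s, π s p z • e s) + fderiv ℝ (π r p) z (∑ s, π s q z • e s) = 0)
    {f g h : E → ℝ} (hf : ContDiff ℝ 2 f) (hg : ContDiff ℝ 2 g) (hh : ContDiff ℝ 2 h) (z : E) :
    bivectorBracket e π (bivectorBracket e π f g) h z
      + bivectorBracket e π (bivectorBracket e π g h) f z
      + bivectorBracket e π (bivectorBracket e π h f) g z = 0 := by
  have hsymm : ∀ {k : E → ℝ}, ContDiff ℝ 2 k → ∀ v w : E,
      fderiv ℝ (fderiv ℝ k) z v w = fderiv ℝ (fderiv ℝ k) z w v := fun hk v w =>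
    (hk.contDiffAt.isSymmSndFDerivAt (by simp)) v w
  have key : (∑ p, ∑ q, fderiv ℝ (π p q) z (hamiltonianVector e π h z)
        * (fderiv ℝ f z (e p) * fderiv ℝ g z (e q)))
      + (∑ q, ∑ r, fderiv ℝ (π q r) z (hamiltonianVector e π f z)
        * (fderiv ℝ g z (e q) * fderiv ℝ h z (e r)))
      + (∑ r, ∑ p, fderiv ℝ (π r p) z (hamiltonianVector e π g z)
        * (fderiv ℝ h z (e r) * fderiv ℝ f z (e p))) = 0 := by
    have expand : ∀ (k l m : E → ℝ),
        (∑ p, ∑ q, fderiv ℝ (π p q) z (hamiltonianVector e π m z)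
          * (fderiv ℝ k z (e p) * fderiv ℝ l z (e q))) =
        ∑ p, ∑ q, ∑ r, fderiv ℝ (π p q) z (∑ s, π s r z • e s)
          * (fderiv ℝ k z (e p) * fderiv ℝ l z (e q) * fderiv ℝ m z (e r)) := by
      intro k l m
      refine Finset.sum_congr rfl fun p _ => Finset.sum_congr rfl fun q _ => ?_
      rw [hamiltonianVector, map_sum, Finset.sum_mul]
      refine Finset.sum_congr rfl fun r _ => ?_
      rw [map_smul, smul_eq_mul]; ring
    rw [expand, expand, expand]
    have rot : ∀ F : ι → ι → ι → ℝ, ∑ p, ∑ q, ∑ r, F p q r = ∑ q, ∑ r, ∑ p, F p q r :=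
      fun F => by
        rw [Finset.sum_comm]
        exact Finset.sum_congr rfl fun _ _ => Finset.sum_comm
    rw [rot fun p q r => fderiv ℝ (π p q) z (∑ s, π s r z • e s)
        * (fderiv ℝ f z (e p) * fderiv ℝ g z (e q) * fderiv ℝ h z (e r)),
      rot fun r p q => fderiv ℝ (π r p) z (∑ s, π s q z • e s)
        * (fderiv ℝ h z (e r) * fderiv ℝ f z (e p) * fderiv ℝ g z (e q)),
      rot fun p q r => fderiv ℝ (π r p) z (∑ s, π s q z • e s)
        * (fderiv ℝ h z (e r) * fderiv ℝ f z (e p) * fderiv ℝ g z (e q))]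
    simp only [← Finset.sum_add_distrib]
    refine Finset.sum_eq_zero fun q _ => Finset.sum_eq_zero fun r _ =>
      Finset.sum_eq_zero fun p _ => ?_
    linear_combination (fderiv ℝ f z (e p) * fderiv ℝ g z (e q) * fderiv ℝ h z (e r)) * hJ p q r z
  rw [bivectorBracket_eq_fderiv, bivectorBracket_eq_fderiv e π _ f,
    bivectorBracket_eq_fderiv e π _ g, fderiv_bivectorBracket e hπ hanti hf hg,
    fderiv_bivectorBracket e hπ hanti hg hh, fderiv_bivectorBracket e hπ hanti hh hf,
    hsymm hf (hamiltonianVector e π h z), hsymm hg (hamiltonianVector e π f z),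
    hsymm hh (hamiltonianVector e π g z)]
  linarith

end BivectorBracket

/-- The coefficient of `a i` in the brackets: the coordinate itself, and `1` for the last `i`. -/
noncomputable def flkCoeff {n : ℕ} (i : Fin n) (z : FlkPt n) : ℝ :=
  if (i : ℕ) + 1 < n then z.1 i else 1

/-- The indicator of `j = i + 1`. -/
def flkSucc {n : ℕ} (i j : Fin n) : ℝ := if (j : ℕ) = (i : ℕ) + 1 then 1 else 0

/-- The coordinate directions: `a` on the left, `b` on the right. -/
noncomputable def flkDir {n : ℕ} : Fin n ⊕ Fin n → FlkPt n
  | .inl i => (Pi.single i 1, 0)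
  | .inr i => (0, Pi.single i 1)

/-- The coordinate brackets of `flk1`. -/
noncomputable def flkBivector {n : ℕ} : Fin n ⊕ Fin n → Fin n ⊕ Fin n → FlkPt n → ℝ
  | .inl i, .inl j => fun z => (flkSucc j i - flkSucc i j) * (flkCoeff i z * flkCoeff j z)
  | .inl i, .inr j => fun z => ((if i = j then 1 else 0) - flkSucc i j) * (flkCoeff i z * z.2 j)
  | .inr i, .inl j => fun z => -(((if j = i then 1 else 0) - flkSucc j i) * (flkCoeff j z * z.2 i))
  | .inr i, .inr j => fun z => flkSucc j i * flkCoeff j z - flkSucc i j * flkCoeff i z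

theorem flk1_eq_bivectorBracket {n : ℕ} (f g : FlkPt n → ℝ) :
    flk1 f g = bivectorBracket flkDir flkBivector f g := by
  have hswap : ∀ F : Fin n → Fin n → ℝ, ∑ i, ∑ j, F i j = ∑ i, ∑ j, F j i :=
    fun F => Finset.sum_comm
  funext z
  have haa : (∑ i : Fin n, ∑ j : Fin n, if (j : ℕ) = (i : ℕ) + 1 then
      (if (j : ℕ) + 1 < n then -(z.1 i * z.1 j) else -(z.1 i))
        * (da f i z * da g j z - da g i z * da f j z) else 0) =
      ∑ i, ∑ j, flkBivector (.inl i) (.inl j) z * (da f i z * da g j z) := by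
    trans (∑ i, ∑ j, -(flkSucc i j * (flkCoeff i z * flkCoeff j z)) * (da f i z * da g j z))
      + ∑ i, ∑ j, flkSucc i j * (flkCoeff i z * flkCoeff j z) * (da f j z * da g i z)
    · simp only [← Finset.sum_add_distrib]
      refine Finset.sum_congr rfl fun i _ => Finset.sum_congr rfl fun j _ => ?_
      simp only [flkSucc, flkCoeff]
      split_ifs <;> first | omega | ring
    · rw [hswap fun i j => flkSucc i j * (flkCoeff i z * flkCoeff j z) * (da f j z * da g i z)]
      simp only [← Finset.sum_add_distrib]
      refine Finset.sum_congr rfl fun i _ => Finset.sum_congr rfl fun j _ => ?_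
      simp only [flkBivector]; ring
  have hab : (∑ i : Fin n, (if (i : ℕ) + 1 < n then z.1 i * z.2 i else z.2 i)
        * (da f i z * db g i z - da g i z * db f i z))
      + (∑ i : Fin n, ∑ j : Fin n, if (j : ℕ) = (i : ℕ) + 1 then
        (-(z.1 i * z.2 j)) * (da f i z * db g j z - da g i z * db f j z) else 0) =
      (∑ i, ∑ j, flkBivector (.inl i) (.inr j) z * (da f i z * db g j z))
      + ∑ i, ∑ j, flkBivector (.inr i) (.inl j) z * (db f i z * da g j z) := by
    rw [hswap fun i j => flkBivector (.inr i) (.inl j) z * (db f i z * da g j z)]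
    simp only [← Finset.sum_add_distrib]
    refine Finset.sum_congr rfl fun i _ => ?_
    trans ∑ j, ((if i = j then (if (i : ℕ) + 1 < n then z.1 i * z.2 i else z.2 i)
        * (da f i z * db g i z - da g i z * db f i z) else 0) +
        if (j : ℕ) = (i : ℕ) + 1 then
        (-(z.1 i * z.2 j)) * (da f i z * db g j z - da g i z * db f j z) else 0)
    · simp [Finset.sum_add_distrib]
    refine Finset.sum_congr rfl fun j _ => ?_
    simp only [flkBivector, flkSucc, flkCoeff]
    by_cases hij : i = j
    · subst hij
      simp only [if_true]
      split_ifs <;> first | omega | ring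
    · simp only [hij, if_false]
      split_ifs <;> first | omega | ring
  have hbb : (∑ i : Fin n, ∑ j : Fin n, if (j : ℕ) = (i : ℕ) + 1 then
      (-(z.1 i)) * (db f i z * db g j z - db g i z * db f j z) else 0) =
      ∑ i, ∑ j, flkBivector (.inr i) (.inr j) z * (db f i z * db g j z) := by
    trans (∑ i, ∑ j, -(flkSucc i j * flkCoeff i z) * (db f i z * db g j z))
      + ∑ i, ∑ j, flkSucc i j * flkCoeff i z * (db f j z * db g i z)
    · simp only [← Finset.sum_add_distrib]
      refine Finset.sum_congr rfl fun i _ => Finset.sum_congr rfl fun j _ => ?_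
      simp only [flkSucc, flkCoeff]
      split_ifs <;> first | omega | ring
    · rw [hswap fun i j => flkSucc i j * flkCoeff i z * (db f j z * db g i z)]
      simp only [← Finset.sum_add_distrib]
      refine Finset.sum_congr rfl fun i _ => Finset.sum_congr rfl fun j _ => ?_
      simp only [flkBivector]; ring
  simp only [bivectorBracket, Fintype.sum_sum_type, Finset.sum_add_distrib]
  rw [flk1, add_assoc (∑ i : Fin n, ∑ j : Fin n, _), haa, hab, hbb]
  simp only [da, db, flkDir]
  ring

theorem flkBivector_antisymm {n : ℕ} (p q : Fin n ⊕ Fin n) (z : FlkPt n) :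
    flkBivector p q z = -flkBivector q p z := by
  rcases p with i | i <;> rcases q with j | j <;> simp only [flkBivector] <;> ring

theorem sum_smul_flkDir {n : ℕ} (c : Fin n ⊕ Fin n → ℝ) :
    ∑ s, c s • flkDir s = (fun i => c (.inl i), fun i => c (.inr i)) := by
  ext i <;> simp [flkDir, Fintype.sum_sum_type, Prod.fst_sum, Prod.snd_sum, Pi.single_apply]

/-- The derivative of `flkCoeff i`. -/
noncomputable def flkCoeffDeriv {n : ℕ} (i : Fin n) : FlkPt n →L[ℝ] ℝ :=
  if (i : ℕ) + 1 < n then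
    (ContinuousLinearMap.proj i).comp (ContinuousLinearMap.fst ℝ (Fin n → ℝ) (Fin n → ℝ)) else 0

theorem flkCoeffDeriv_apply {n : ℕ} (i : Fin n) (v : FlkPt n) :
    flkCoeffDeriv i v = if (i : ℕ) + 1 < n then v.1 i else 0 := by
  unfold flkCoeffDeriv
  split_ifs <;> rfl

theorem hasFDerivAt_flkCoeff {n : ℕ} (i : Fin n) (z : FlkPt n) :
    HasFDerivAt (flkCoeff i) (flkCoeffDeriv i) z := by
  unfold flkCoeff flkCoeffDeriv
  split_ifs
  · exact ContinuousLinearMap.hasFDerivAt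
      ((ContinuousLinearMap.proj i).comp (ContinuousLinearMap.fst ℝ (Fin n → ℝ) (Fin n → ℝ)))
  · exact hasFDerivAt_const 1 z

theorem hasFDerivAt_snd_apply {n : ℕ} (j : Fin n) (z : FlkPt n) :
    HasFDerivAt (fun z : FlkPt n => z.2 j) ((ContinuousLinearMap.proj j).comp
      (ContinuousLinearMap.snd ℝ (Fin n → ℝ) (Fin n → ℝ))) z :=
  ContinuousLinearMap.hasFDerivAt
    ((ContinuousLinearMap.proj j).comp (ContinuousLinearMap.snd ℝ (Fin n → ℝ) (Fin n → ℝ)))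

theorem differentiable_flkCoeff {n : ℕ} (i : Fin n) : Differentiable ℝ (flkCoeff i) :=
  fun z => (hasFDerivAt_flkCoeff i z).differentiableAt

theorem differentiable_flkBivector {n : ℕ} (p q : Fin n ⊕ Fin n) :
    Differentiable ℝ (flkBivector p q) := by
  have hA := differentiable_flkCoeff (n := n)
  have hb : ∀ j : Fin n, Differentiable ℝ fun z : FlkPt n => z.2 j := fun j => by fun_prop
  rcases p with i | i <;> rcases q with j | j <;> simp only [flkBivector]
  · exact ((hA i).mul (hA j)).const_mul _
  · exact ((hA i).mul (hb j)).const_mul _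
  · exact (((hA j).mul (hb i)).const_mul _).neg
  · exact ((hA j).const_mul _).sub ((hA i).const_mul _)

theorem fderiv_flkBivector_inl_inl {n : ℕ} (i j : Fin n) (z v : FlkPt n) :
    fderiv ℝ (flkBivector (.inl i) (.inl j)) z v = (flkSucc j i - flkSucc i j)
      * (flkCoeff i z * flkCoeffDeriv j v + flkCoeff j z * flkCoeffDeriv i v) := by
  have h := ((hasFDerivAt_flkCoeff i z).mul (hasFDerivAt_flkCoeff j z)).const_mul
    (flkSucc j i - flkSucc i j)
  exact congrArg (· v) h.fderiv

theorem fderiv_flkBivector_inl_inr {n : ℕ} (i j : Fin n) (z v : FlkPt n) :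
    fderiv ℝ (flkBivector (.inl i) (.inr j)) z v = ((if i = j then 1 else 0) - flkSucc i j)
      * (flkCoeff i z * v.2 j + z.2 j * flkCoeffDeriv i v) := by
  have h := ((hasFDerivAt_flkCoeff i z).mul (hasFDerivAt_snd_apply j z)).const_mul
    ((if i = j then 1 else 0) - flkSucc i j)
  exact congrArg (· v) h.fderiv

theorem fderiv_flkBivector_inr_inr {n : ℕ} (i j : Fin n) (z v : FlkPt n) :
    fderiv ℝ (flkBivector (.inr i) (.inr j)) z v =
      flkSucc j i * flkCoeffDeriv j v - flkSucc i j * flkCoeffDeriv i v := by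
  have h := ((hasFDerivAt_flkCoeff j z).const_mul (flkSucc j i)).sub
    ((hasFDerivAt_flkCoeff i z).const_mul (flkSucc i j))
  exact congrArg (· v) h.fderiv

theorem fderiv_flkBivector_inr_inl {n : ℕ} (i j : Fin n) (z v : FlkPt n) :
    fderiv ℝ (flkBivector (.inr i) (.inl j)) z v = -(((if j = i then 1 else 0) - flkSucc j i)
      * (flkCoeff j z * v.2 i + z.2 i * flkCoeffDeriv j v)) := by
  have h := (((hasFDerivAt_flkCoeff j z).mul (hasFDerivAt_snd_apply i z)).const_mul
    ((if j = i then 1 else 0) - flkSucc j i)).neg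
  exact congrArg (· v) h.fderiv

/-- The Hamiltonian vector field of the coordinate indexed by `r`. -/
noncomputable def flkField {n : ℕ} (r : Fin n ⊕ Fin n) (z : FlkPt n) : FlkPt n :=
  ∑ s, flkBivector s r z • flkDir s

theorem flkField_fst {n : ℕ} (r : Fin n ⊕ Fin n) (z : FlkPt n) (i : Fin n) :
    (flkField r z).1 i = flkBivector (.inl i) r z := by
  rw [flkField, sum_smul_flkDir fun s => flkBivector s r z]

theorem flkField_snd {n : ℕ} (r : Fin n ⊕ Fin n) (z : FlkPt n) (i : Fin n) :
    (flkField r z).2 i = flkBivector (.inr i) r z := by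
  rw [flkField, sum_smul_flkDir fun s => flkBivector s r z]

theorem flkBivector_jacobi_inl_inl_inl {n : ℕ} (i j k : Fin n) (z : FlkPt n) :
    fderiv ℝ (flkBivector (.inl i) (.inl j)) z (flkField (.inl k) z)
      + fderiv ℝ (flkBivector (.inl j) (.inl k)) z (flkField (.inl i) z)
      + fderiv ℝ (flkBivector (.inl k) (.inl i)) z (flkField (.inl j) z) = 0 := by
  simp only [fderiv_flkBivector_inl_inl, flkCoeffDeriv_apply, flkField_fst]
  simp only [flkBivector]
  split_ifs <;> ring

theorem flkBivector_jacobi_inl_inl_inr {n : ℕ} (i j k : Fin n) (z : FlkPt n) :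
    fderiv ℝ (flkBivector (.inl i) (.inl j)) z (flkField (.inr k) z)
      + fderiv ℝ (flkBivector (.inl j) (.inr k)) z (flkField (.inl i) z)
      + fderiv ℝ (flkBivector (.inr k) (.inl i)) z (flkField (.inl j) z) = 0 := by
  simp only [fderiv_flkBivector_inl_inl, fderiv_flkBivector_inl_inr, fderiv_flkBivector_inr_inl,
    flkCoeffDeriv_apply, flkField_fst, flkField_snd]
  simp only [flkBivector]
  by_cases hi : (i : ℕ) + 1 < n <;> by_cases hj : (j : ℕ) + 1 < n <;>
    simp only [hi, hj, if_true, if_false] <;> ring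

theorem flkBivector_jacobi_inl_inr_inr {n : ℕ} (i j k : Fin n) (z : FlkPt n) :
    fderiv ℝ (flkBivector (.inl i) (.inr j)) z (flkField (.inr k) z)
      + fderiv ℝ (flkBivector (.inr j) (.inr k)) z (flkField (.inl i) z)
      + fderiv ℝ (flkBivector (.inr k) (.inl i)) z (flkField (.inr j) z) = 0 := by
  simp only [fderiv_flkBivector_inr_inr, fderiv_flkBivector_inl_inr, fderiv_flkBivector_inr_inl,
    flkCoeffDeriv_apply, flkField_fst, flkField_snd]
  simp only [flkBivector, flkSucc]
  grind

theorem flkBivector_jacobi_inr_inr_inr {n : ℕ} (i j k : Fin n) (z : FlkPt n) :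
    fderiv ℝ (flkBivector (.inr i) (.inr j)) z (flkField (.inr k) z)
      + fderiv ℝ (flkBivector (.inr j) (.inr k)) z (flkField (.inr i) z)
      + fderiv ℝ (flkBivector (.inr k) (.inr i)) z (flkField (.inr j) z) = 0 := by
  simp only [fderiv_flkBivector_inr_inr, flkCoeffDeriv_apply, flkField_fst]
  simp only [flkBivector, flkSucc]
  grind

theorem flkBivector_jacobi {n : ℕ} (p q r : Fin n ⊕ Fin n) (z : FlkPt n) :
    fderiv ℝ (flkBivector p q) z (flkField r z) + fderiv ℝ (flkBivector q r) z (flkField p z)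
      + fderiv ℝ (flkBivector r p) z (flkField q z) = 0 := by
  rcases p with i | i <;> rcases q with j | j <;> rcases r with k | k
  · exact flkBivector_jacobi_inl_inl_inl i j k z
  · exact flkBivector_jacobi_inl_inl_inr i j k z
  · linarith [flkBivector_jacobi_inl_inl_inr k i j z]
  · exact flkBivector_jacobi_inl_inr_inr i j k z
  · linarith [flkBivector_jacobi_inl_inl_inr j k i z]
  · linarith [flkBivector_jacobi_inl_inr_inr j k i z]
  · linarith [flkBivector_jacobi_inl_inr_inr k i j z]
  · exact flkBivector_jacobi_inr_inr_inr i j k z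

/-- The second Toda bracket in extended Flaschka coordinates satisfies the
Jacobi identity, hence is a Poisson bracket. -/
theorem flk1_jacobi {n : ℕ} (f g h : FlkPt n → ℝ)
    (hf : ContDiff ℝ (⊤ : ℕ∞) f) (hg : ContDiff ℝ (⊤ : ℕ∞) g) (hh : ContDiff ℝ (⊤ : ℕ∞) h) :
    ∀ z : FlkPt n,
      flk1 (flk1 f g) h z + flk1 (flk1 g h) f z + flk1 (flk1 h f) g z = 0 := by
  intro z
  have two_le : (2 : WithTop ℕ∞) ≤ ((⊤ : ℕ∞) : WithTop ℕ∞) :=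
    WithTop.coe_le_coe.2 (le_top (a := (2 : ℕ∞)))
  simp only [flk1_eq_bivectorBracket]
  exact bivectorBracket_jacobi flkDir differentiable_flkBivector flkBivector_antisymm
    flkBivector_jacobi (hf.of_le two_le) (hg.of_le two_le) (hh.of_le two_le) z
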